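/- For the spin-1/2 particle in a rotating magnetic field with resonant driving ω = −ω₀ cos θ (so that ω̄ = √(ω₀² + ω² + 2ω₀ω cos θ) = |ω₀| sin θ for 0 < θ < π), the adiabatic error satisfies ‖Q(t)U(t)P(0)‖ = |sin(ω₀ sin(θ) t/2)|; in particular the error reaches 1, i.e., a complete transition from spin-down to spin-up occurs, even though the instantaneous spectral gap is constantly equal to |ω₀|. -/

import Mathlib

open scoped Matrix Matrix.Norms.L2Operator in
/-- The spectral norm of a `2 × 2` matrix whose only nonzero entry is the lower left one. -/
lemma norm_toEuclideanCLM_lower_left (b : ℂ) :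
    ‖Matrix.toEuclideanCLM (n := Fin 2) (𝕜 := ℂ) !![0, 0; b, 0]‖ = ‖b‖ := by
  rw [Matrix.l2_opNorm_toEuclideanCLM]
  have hdiag : (!![0, 0; b, 0] : Matrix (Fin 2) (Fin 2) ℂ)ᴴ * !![0, 0; b, 0] =
      Matrix.diagonal ![star b * b, 0] := by
    ext i j
    fin_cases i <;> fin_cases j <;> simp [Matrix.mul_apply, Matrix.conjTranspose_apply]
  have hsq := Matrix.l2_opNorm_conjTranspose_mul_self
    (!![0, 0; b, 0] : Matrix (Fin 2) (Fin 2) ℂ)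
  have hnorm : ‖(![star b * b, 0] : Fin 2 → ℂ)‖ = ‖b‖ * ‖b‖ := by
    refine le_antisymm ((pi_norm_le_iff_of_nonneg (by positivity)).2 fun i => ?_) ?_
    · fin_cases i <;> simp [mul_self_nonneg]
    · simpa using norm_le_pi_norm (![star b * b, 0] : Fin 2 → ℂ) 0
  rw [hdiag, Matrix.l2_opNorm_diagonal, hnorm] at hsq
  exact ((mul_self_inj (norm_nonneg _) (norm_nonneg _)).1 hsq).symm

/-- The solution of the scalar linear equation `f' = c f` is `f 0 * exp (c t)`. -/
lemma eq_mul_exp_of_hasDerivAt {f : ℝ → ℂ} {c : ℂ}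
    (hf : ∀ t, HasDerivAt f (c * f t) t) (t : ℝ) :
    f t = f 0 * Complex.exp (c * t) := by
  have hexp (s : ℝ) : HasDerivAt (fun s : ℝ => Complex.exp (-(c * s)))
      (Complex.exp (-(c * s)) * -(c * 1)) s :=
    (((hasDerivAt_id s).ofReal_comp.const_mul c).neg).cexp
  have hd (s : ℝ) : HasDerivAt (fun s : ℝ => f s * Complex.exp (-(c * s))) 0 s := by
    refine ((hf s).mul (hexp s)).congr_deriv ?_
    ring
  have hconst := is_const_of_deriv_eq_zero (fun s => (hd s).differentiableAt)
    (fun s => (hd s).deriv) t 0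
  simp only [Complex.ofReal_zero, mul_zero, neg_zero, Complex.exp_zero, mul_one] at hconst
  rw [← hconst, mul_assoc, ← Complex.exp_add]
  simp

/-- Rabi oscillation: two coupled amplitudes exchanging the excitation. -/
lemma eq_I_mul_sin_of_hasDerivAt {f g : ℝ → ℂ} {k : ℝ}
    (hf : ∀ t, HasDerivAt f (Complex.I * k * g t) t)
    (hg : ∀ t, HasDerivAt g (Complex.I * k * f t) t)
    (hf0 : f 0 = 1) (hg0 : g 0 = 0) (t : ℝ) :
    g t = Complex.I * Complex.sin (k * t) := by
  have hadd := eq_mul_exp_of_hasDerivAt (f := fun t => f t + g t) (c := Complex.I * k)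
    (fun t => ((hf t).add (hg t)).congr_deriv (by ring)) t
  have hsub := eq_mul_exp_of_hasDerivAt (f := fun t => f t - g t) (c := -(Complex.I * k))
    (fun t => ((hf t).sub (hg t)).congr_deriv (by ring)) t
  simp only [hf0, hg0, add_zero, sub_zero, one_mul] at hadd hsub
  have h1 : Complex.exp (-(k * t) * Complex.I) = Complex.exp (-(Complex.I * k) * t) := by
    congr 1; ring
  have h2 : Complex.exp (k * t * Complex.I) = Complex.exp (Complex.I * k * t) := by
    congr 1; ring
  rw [Complex.sin, h1, h2, ← hadd, ← hsub]
  linear_combination g t * Complex.I_sq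

/-- A traceless `2 × 2` matrix with determinant `-e ^ 2` has spectrum `{-e, e}`. -/
lemma spectrum_eq_pair_of_trace_zero {A : Matrix (Fin 2) (Fin 2) ℂ} {e : ℂ}
    (htr : A.trace = 0) (hdet : A.det = -e ^ 2) : spectrum ℂ A = {-e, e} := by
  ext z
  rw [Matrix.mem_spectrum_iff_isRoot_charpoly, Matrix.charpoly_fin_two, htr, hdet]
  have hfac : z ^ 2 - e ^ 2 = (z - -e) * (z - e) := by ring
  simp [Polynomial.IsRoot, ← sub_eq_add_neg, hfac, sub_eq_zero, add_eq_zero_iff_eq_neg]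


/-- For the spin-1/2 particle in a rotating magnetic field with resonant
driving `ω = -ω₀ cos θ` (so `ω̄ = √(ω₀² + ω² + 2ω₀ω cos θ) = |ω₀| sin θ` for
`0 < θ < π`), the adiabatic error satisfies
`‖Q U(t) P‖ = |sin(ω₀ sin(θ) t / 2)|`; in particular the error reaches `1`
(a complete spin-down → spin-up transition), even though the instantaneous
spectrum of `H(t)` is constantly `{-ω₀/2, ω₀/2}`, i.e. the spectral gap is
constantly `|ω₀|`. -/
theorem rotating_field_resonant_complete_transition
    (ω₀ ω θ : ℝ)
    (hω₀ : ω₀ ≠ 0) (hθ₀ : 0 < θ) (hθπ : θ < Real.pi)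
    (hres : ω = -ω₀ * Real.cos θ)
    (H U : ℝ → Matrix (Fin 2) (Fin 2) ℂ)
    (hH : ∀ t : ℝ, H t = (-(ω₀ : ℂ) / 2) •
      !![((Real.cos θ : ℝ) : ℂ),
           Complex.exp (-Complex.I * ((ω * t : ℝ) : ℂ)) * ((Real.sin θ : ℝ) : ℂ);
         Complex.exp (Complex.I * ((ω * t : ℝ) : ℂ)) * ((Real.sin θ : ℝ) : ℂ),
           -((Real.cos θ : ℝ) : ℂ)])
    -- `U` is the exact solution of Schrödinger's equation
    (hU0 : U 0 = 1)
    (hU : ∀ (t : ℝ) (i j : Fin 2),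
      HasDerivAt (fun t' => U t' i j) (((-Complex.I) • (H t * U t)) i j) t) :
    (∀ t : ℝ,
      ‖Matrix.toEuclideanCLM (n := Fin 2) (𝕜 := ℂ)
          ((!![0, 0; 0, 1] : Matrix (Fin 2) (Fin 2) ℂ) * U t * !![1, 0; 0, 0])‖ =
        |Real.sin (ω₀ * Real.sin θ * t / 2)|) ∧
    (∃ t : ℝ,
      ‖Matrix.toEuclideanCLM (n := Fin 2) (𝕜 := ℂ)
          ((!![0, 0; 0, 1] : Matrix (Fin 2) (Fin 2) ℂ) * U t * !![1, 0; 0, 0])‖ =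
        1) ∧
    (∀ t : ℝ, spectrum ℂ (H t) = {-(ω₀ : ℂ) / 2, (ω₀ : ℂ) / 2}) := by
  have hres' : (ω : ℂ) = -ω₀ * (Real.cos θ : ℝ) := by exact_mod_cast hres
  have hdA (t : ℝ) : HasDerivAt (fun t : ℝ => Complex.exp (Complex.I * ω / 2 * t) * U t 0 0)
      (Complex.I * ((ω₀ * Real.sin θ / 2 : ℝ) : ℂ) *
        (Complex.exp (-(Complex.I * ω / 2) * t) * U t 1 0)) t := by
    have hexp : HasDerivAt (fun t : ℝ => Complex.exp (Complex.I * ω / 2 * t))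
        (Complex.exp (Complex.I * ω / 2 * t) * (Complex.I * ω / 2 * 1)) t :=
      ((hasDerivAt_id t).ofReal_comp.const_mul (Complex.I * ω / 2)).cexp
    refine (hexp.mul (hU t 0 0)).congr_deriv ?_
    have hmul : Complex.exp (-(Complex.I * ω / 2) * t) =
        Complex.exp (Complex.I * ω / 2 * t) * Complex.exp (-Complex.I * ((ω * t : ℝ) : ℂ)) := by
      rw [← Complex.exp_add]
      congr 1
      push_cast
      ring
    rw [hmul, hH]
    simp only [Matrix.smul_apply, Matrix.mul_apply, Fin.sum_univ_two, smul_eq_mul,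
      Matrix.of_apply, Matrix.cons_val', Matrix.cons_val_zero, Matrix.cons_val_one,
      Matrix.cons_val_fin_one, Complex.ofReal_div, Complex.ofReal_mul ω₀, Complex.ofReal_ofNat]
    linear_combination
      (Complex.I / 2 * Complex.exp (Complex.I * ω / 2 * t) * U t 0 0) * hres'
  have hdB (t : ℝ) : HasDerivAt (fun t : ℝ => Complex.exp (-(Complex.I * ω / 2) * t) * U t 1 0)
      (Complex.I * ((ω₀ * Real.sin θ / 2 : ℝ) : ℂ) *
        (Complex.exp (Complex.I * ω / 2 * t) * U t 0 0)) t := by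
    have hexp : HasDerivAt (fun t : ℝ => Complex.exp (-(Complex.I * ω / 2) * t))
        (Complex.exp (-(Complex.I * ω / 2) * t) * (-(Complex.I * ω / 2) * 1)) t :=
      ((hasDerivAt_id t).ofReal_comp.const_mul (-(Complex.I * ω / 2))).cexp
    refine (hexp.mul (hU t 1 0)).congr_deriv ?_
    have hmul : Complex.exp (Complex.I * ω / 2 * t) =
        Complex.exp (-(Complex.I * ω / 2) * t) * Complex.exp (Complex.I * ((ω * t : ℝ) : ℂ)) := by
      rw [← Complex.exp_add]
      congr 1
      push_cast
      ring
    rw [hmul, hH]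
    simp only [Matrix.smul_apply, Matrix.mul_apply, Fin.sum_univ_two, smul_eq_mul,
      Matrix.of_apply, Matrix.cons_val', Matrix.cons_val_zero, Matrix.cons_val_one,
      Matrix.cons_val_fin_one, Complex.ofReal_div, Complex.ofReal_mul ω₀, Complex.ofReal_ofNat]
    linear_combination
      (-Complex.I / 2 * Complex.exp (-(Complex.I * ω / 2) * t) * U t 1 0) * hres'
  have herr (t : ℝ) : ‖Matrix.toEuclideanCLM (n := Fin 2) (𝕜 := ℂ)
      ((!![0, 0; 0, 1] : Matrix (Fin 2) (Fin 2) ℂ) * U t * !![1, 0; 0, 0])‖ =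
        |Real.sin (ω₀ * Real.sin θ * t / 2)| := by
    have hentry : (!![0, 0; 0, 1] : Matrix (Fin 2) (Fin 2) ℂ) * U t * !![1, 0; 0, 0] =
        !![0, 0; U t 1 0, 0] := by
      ext i j
      fin_cases i <;> fin_cases j <;> simp [Matrix.vecMul, dotProduct, Matrix.mul_apply]
    have hB := congrArg norm (eq_I_mul_sin_of_hasDerivAt hdA hdB (by simp [hU0]) (by simp [hU0]) t)
    rw [norm_mul, norm_mul, Complex.norm_I, one_mul, ← Complex.ofReal_mul, ← Complex.ofReal_sin,
      Complex.norm_real, Complex.norm_exp] at hB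
    rw [hentry, norm_toEuclideanCLM_lower_left, ← Real.norm_eq_abs, mul_div_right_comm, ← hB]
    simp
  refine ⟨herr, ⟨Real.pi / (ω₀ * Real.sin θ), ?_⟩, fun t => ?_⟩
  · have hk : ω₀ * Real.sin θ ≠ 0 := mul_ne_zero hω₀ (Real.sin_pos_of_pos_of_lt_pi hθ₀ hθπ).ne'
    rw [herr, mul_div_cancel₀ _ hk, Real.sin_pi_div_two, abs_one]
  · have hcs : (Real.cos θ : ℂ) ^ 2 + (Real.sin θ : ℂ) ^ 2 = 1 := by
      exact_mod_cast Real.cos_sq_add_sin_sq θ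
    have hexp : Complex.exp (-Complex.I * ((ω * t : ℝ) : ℂ)) *
        Complex.exp (Complex.I * ((ω * t : ℝ) : ℂ)) = 1 := by
      rw [← Complex.exp_add, neg_mul, neg_add_cancel, Complex.exp_zero]
    rw [neg_div]
    refine spectrum_eq_pair_of_trace_zero ?_ ?_
    · rw [hH, Matrix.trace_smul, Matrix.trace_fin_two_of, add_neg_cancel, smul_zero]
    · rw [hH, Matrix.det_smul, Matrix.det_fin_two_of, Fintype.card_fin]
      linear_combination -(ω₀ : ℂ) ^ 2 / 4 * hcs -
        (ω₀ : ℂ) ^ 2 / 4 * (Real.sin θ : ℂ) ^ 2 * hexp
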